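/- Let G = (L ∪ R, E) be a finite bipartite simple graph with parts L and R, let H ⊆ E, and let A ⊆ R be a set with |A| − |N_H(A)| = |R| − μ(H), where N_H(A) = {u ∈ L : {u,a} ∈ H for some a ∈ A}. Then there exists a matching M ⊆ E of size |M| ≥ μ(G) − μ(H) such that every edge of M joins a vertex of A to a vertex of L ∖ N_H(A); in particular M ⊆ E ∖ H. -/

import Mathlib

open Finset
open scoped Classical

/-- The degree of a vertex `v` in an edge set `H`: the number of edges of `H` incident to `v`. -/
noncomputable def degV {V : Type*} (H : Finset (Sym2 V)) (v : V) : ℕ :=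
  (H.filter (fun e => v ∈ e)).card

/-- The edge degree of an unordered pair `e = {u,w}` in an edge set `H`:
`deg_H(u) + deg_H(w)`. -/
noncomputable def degE {V : Type*} (H : Finset (Sym2 V)) (e : Sym2 V) : ℕ :=
  Sym2.lift ⟨fun u w => degV H u + degV H w, fun _ _ => add_comm _ _⟩ e

/-- `M` is a matching: its edges are non-loops and pairwise vertex-disjoint. -/
def IsMatching {V : Type*} (M : Finset (Sym2 V)) : Prop :=
  (∀ e ∈ M, ¬ e.IsDiag) ∧ ∀ e ∈ M, ∀ f ∈ M, e ≠ f → ∀ v : V, v ∈ e → v ∉ f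

/-- `matchNum F` = μ(F), the maximum size of a matching contained in the edge set `F`. -/
noncomputable def matchNum {V : Type*} (F : Finset (Sym2 V)) : ℕ :=
  F.powerset.sup (fun M => if IsMatching M then M.card else 0)

/-- Some matching contained in `F` attains `matchNum F`. -/
theorem exists_isMatching_card_eq_matchNum {V : Type*} (F : Finset (Sym2 V)) :
    ∃ M ⊆ F, IsMatching M ∧ M.card = matchNum F := by
  obtain ⟨M, hM, hcard⟩ := F.powerset.exists_mem_eq_sup ⟨∅, F.empty_mem_powerset⟩
    (fun M => if IsMatching M then M.card else 0)
  by_cases hm : IsMatching M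
  · exact ⟨M, mem_powerset.mp hM, hm, by rw [matchNum, hcard, if_pos hm]⟩
  · exact ⟨∅, empty_subset F, by simp [IsMatching], by rw [matchNum, hcard, if_neg hm, card_empty]⟩

theorem IsMatching.mono {V : Type*} {M M' : Finset (Sym2 V)} (hM : IsMatching M) (h : M' ⊆ M) :
    IsMatching M' :=
  ⟨fun e he => hM.1 e (h he), fun e he f hf => hM.2 e (h he) f (h hf)⟩

/-- A matching is no larger than any set of vertices covering all its edges. -/
theorem IsMatching.card_le_of_cover {V : Type*} {M : Finset (Sym2 V)} (hM : IsMatching M)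
    {C : Finset V} (hC : ∀ e ∈ M, ∃ v ∈ C, v ∈ e) : M.card ≤ C.card :=
  card_le_card_of_forall_subsingleton (fun e v => v ∈ e) hC fun v _ e he f hf => by
    by_contra hne
    exact hM.2 e he.1 f hf.1 hne v he.2 hf.2

/-- Hall-deficiency witness — if A ⊆ R satisfies
|A| − |N_H(A)| = |R| − μ(H), then there is a matching M ⊆ E ∖ H of size ≥ μ(G) − μ(H)
whose edges all join A to L ∖ N_H(A). -/
theorem hall_deficiency_matching (V : Type) (L R : Finset V) (hLR : Disjoint L R)
    (E : Finset (Sym2 V)) (hbip : ∀ e ∈ E, ∃ u ∈ L, ∃ w ∈ R, e = s(u, w))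
    (H : Finset (Sym2 V)) (hHE : H ⊆ E)
    (A : Finset V) (hA : A ⊆ R)
    (N : Finset V) (hN : N = L.filter (fun u => ∃ a ∈ A, s(u, a) ∈ H))
    (hdef : (A.card : ℤ) - N.card = (R.card : ℤ) - matchNum H) :
    ∃ M : Finset (Sym2 V), M ⊆ E ∧ IsMatching M ∧
      (matchNum E : ℤ) - matchNum H ≤ (M.card : ℤ) ∧
      (∀ e ∈ M, ∃ a ∈ A, ∃ u ∈ L, u ∉ N ∧ e = s(u, a)) ∧
      ∀ e ∈ M, e ∉ H := by
  obtain ⟨M₀, hM₀E, hM₀, hcard⟩ := exists_isMatching_card_eq_matchNum E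
  let P : Sym2 V → Prop := fun e => ∃ a ∈ A, ∃ u ∈ L, u ∉ N ∧ e = s(u, a)
  refine ⟨M₀.filter P, (filter_subset _ _).trans hM₀E, hM₀.mono (filter_subset _ _), ?_,
    fun e he => (mem_filter.mp he).2, ?_⟩
  · have hrest : (M₀.filter fun e => ¬ P e).card ≤ (N ∪ R \ A).card := by
      refine (hM₀.mono (filter_subset _ _)).card_le_of_cover fun e he => ?_
      obtain ⟨heM, heP⟩ := mem_filter.mp he
      obtain ⟨u, hu, w, hw, rfl⟩ := hbip e (hM₀E heM)
      by_cases huN : u ∈ N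
      · exact ⟨u, mem_union_left _ huN, Sym2.mem_mk_left u w⟩
      · have hwA : w ∉ A := fun hwA => heP ⟨w, hwA, u, hu, huN, rfl⟩
        exact ⟨w, mem_union_right _ (mem_sdiff.mpr ⟨hw, hwA⟩), Sym2.mem_mk_right u w⟩
    have hunion := card_union_le N (R \ A)
    have hsdiff := card_sdiff_add_card_eq_card hA
    have hsplit := card_filter_add_card_filter_not (s := M₀) P
    omega
  · intro e he heH
    obtain ⟨a, ha, u, hu, huN, rfl⟩ := (mem_filter.mp he).2
    exact huN (hN ▸ mem_filter.mpr ⟨hu, a, ha, heH⟩)
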